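/- Let V be a complex vector space and let X, Y ∈ V be linearly independent over C. Suppose W is a 2-dimensional real vector subspace of the complex span of X and Y such that X + Y ∈ W and such that for every real number x, the C-linear map sending X to e^{ix}X and Y to e^{-ix}Y maps W into W. Then W = {zX + z̄Y : z ∈ C}. -/

import Mathlib

/-- A complex linear map can be prescribed on two linearly independent vectors. -/
theorem LinearIndependent.exists_linearMap_pair {V : Type*} [AddCommGroup V] [Module ℂ V]
    {X Y : V} (hXY : LinearIndependent ℂ ![X, Y]) (X' Y' : V) :
    ∃ f : V →ₗ[ℂ] V, f X = X' ∧ f Y = Y' := by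
  obtain ⟨g, hg⟩ := LinearMap.exists_leftInverse_of_injective
    (Fintype.linearCombination ℂ ![X, Y])
    (LinearMap.ker_eq_bot.2 (linearIndependent_iff_injective_fintypeLinearCombination.1 hXY))
  have h (i : Fin 2) : g (![X, Y] i) = Pi.single i 1 := by
    simpa using LinearMap.congr_fun hg (Pi.single i 1)
  have h0 : g X = Pi.single 0 1 := h 0
  have h1 : g Y = Pi.single 1 1 := h 1
  exact ⟨Fintype.linearCombination ℂ ![X', Y'] ∘ₗ g, by simp [h0], by simp [h1]⟩

/-- The vectors `X + Y` and `i (X - Y)` are linearly independent over `ℝ` when `X` and `Y` are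
linearly independent over `ℂ`. -/
theorem LinearIndependent.real_pair_add_I_smul_sub {V : Type*} [AddCommGroup V] [Module ℂ V]
    {X Y : V} (hXY : LinearIndependent ℂ ![X, Y]) :
    LinearIndependent ℝ ![X + Y, Complex.I • (X - Y)] := by
  rw [LinearIndependent.pair_iff] at hXY ⊢
  intro a b hab
  have h := (hXY (a + b * Complex.I) (a - b * Complex.I) (by
    rw [← hab, ← Complex.coe_smul a, ← Complex.coe_smul b]
    module)).1
  simpa using And.intro (congrArg Complex.re h) (congrArg Complex.im h)

/-- If `W` is a 2-dimensional real subspace of the complex span of linearly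
independent vectors `X, Y` containing `X + Y` and stable under all maps
`X ↦ e^{ix} X, Y ↦ e^{-ix} Y` (`x ∈ ℝ`), then `W = {z X + z̄ Y : z ∈ ℂ}`. -/
theorem realForm_of_rotation_invariant {V : Type*} [AddCommGroup V] [Module ℂ V] (X Y : V)
    (hXY : LinearIndependent ℂ ![X, Y]) (W : Submodule ℝ V)
    (hdim : Module.finrank ℝ W = 2)
    (hsub : (W : Set V) ⊆ (Submodule.span ℂ ({X, Y} : Set V) : Set V))
    (hmem : X + Y ∈ W)
    (hrot : ∀ (x : ℝ) (f : V →ₗ[ℂ] V),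
      f X = Complex.exp (x * Complex.I) • X →
      f Y = Complex.exp (-(x * Complex.I)) • Y →
      ∀ w ∈ W, f w ∈ W) :
    (W : Set V) = {v | ∃ z : ℂ, v = z • X + (starRingEnd ℂ z) • Y} := by
  have hmem' : Complex.I • (X - Y) ∈ W := by
    obtain ⟨f, hX, hY⟩ := hXY.exists_linearMap_pair
      (Complex.exp ((Real.pi / 2 : ℝ) * Complex.I) • X)
      (Complex.exp (-((Real.pi / 2 : ℝ) * Complex.I)) • Y)
    have h := hrot _ f hX hY _ hmem
    rw [map_add, hX, hY, Complex.exp_neg] at h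
    push_cast at h
    rw [Complex.exp_pi_div_two_mul_I, Complex.inv_I] at h
    convert h using 1
    module
  have hspan : Submodule.span ℝ {X + Y, Complex.I • (X - Y)} = W := by
    have : FiniteDimensional ℝ W := Module.finite_of_finrank_pos (by omega)
    refine Submodule.eq_of_le_of_finrank_eq (Submodule.span_le.2 ?_) ?_
    · rintro v (rfl | rfl)
      exacts [hmem, hmem']
    · rw [hdim, ← Matrix.range_cons_cons_empty _ _ ![]]
      exact finrank_span_eq_card hXY.real_pair_add_I_smul_sub
  ext v
  rw [SetLike.mem_coe, ← hspan, Submodule.mem_span_pair, Set.mem_ofPred_eq]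
  constructor
  · rintro ⟨a, b, rfl⟩
    refine ⟨a + b * Complex.I, ?_⟩
    rw [← Complex.coe_smul a, ← Complex.coe_smul b]
    simp only [map_add, map_mul, Complex.conj_ofReal, Complex.conj_I]
    module
  · rintro ⟨z, rfl⟩
    refine ⟨z.re, z.im, ?_⟩
    rw [← Complex.coe_smul z.re, ← Complex.coe_smul z.im]
    conv_rhs => rw [← Complex.re_add_im z]
    simp only [map_add, map_mul, Complex.conj_ofReal, Complex.conj_I]
    module
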